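/- arXiv:2102.13341 — 2 statements merged into one kernel-verified Lean document; each statement's English description precedes it below -/
import Mathlib

section
/- Infinitesimal characterization of helical covariance for vector fields: let σ > 0 and let u = (u₁,u₂,u₃): ℝ³ → ℝ³ be differentiable everywhere. Then u is helical covariant with step σ if and only if for every x = (x₁,x₂,x₃) ∈ ℝ³ one has Du(x)(x₂, −x₁, σ/(2π)) = (u₂(x), −u₁(x), 0), i.e. the derivative of u along the helical generator ζ_σ(x) equals M′(0)u(x). -/
/-- The helical transformation `S_{θ,σ}` on `ℝ³`. -/
noncomputable def helS (σ θ : ℝ) (x : Fin 3 → ℝ) : Fin 3 → ℝ :=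
  ![x 0 * Real.cos θ + x 1 * Real.sin θ,
    -(x 0) * Real.sin θ + x 1 * Real.cos θ,
    x 2 + σ * θ / (2 * Real.pi)]


/-- The rotation matrix `M(θ)`. -/
noncomputable def helM (θ : ℝ) : Matrix (Fin 3) (Fin 3) ℝ :=
  !![Real.cos θ, Real.sin θ, 0; -(Real.sin θ), Real.cos θ, 0; 0, 0, 1]

/-- The orbits of the helical group are the integral curves of its generator. -/
theorem hasDerivAt_helS (σ θ : ℝ) (x : Fin 3 → ℝ) :
    HasDerivAt (fun t => helS σ t x)
      ![helS σ θ x 1, -(helS σ θ x 0), σ / (2 * Real.pi)] θ := by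
  rw [hasDerivAt_pi]
  have hc := Real.hasDerivAt_cos θ
  have hs := Real.hasDerivAt_sin θ
  intro i
  fin_cases i
  · refine ((hc.const_mul (x 0)).add (hs.const_mul (x 1))).congr_deriv ?_
    simp [helS]
  · refine ((hs.const_mul (-(x 0))).add (hc.const_mul (x 1))).congr_deriv ?_
    simp [helS]
    ring
  · refine ((((hasDerivAt_id θ).const_mul σ).div_const (2 * Real.pi)).const_add
      (x 2)).congr_deriv ?_
    simp

theorem helS_zero (σ : ℝ) (x : Fin 3 → ℝ) : helS σ 0 x = x := by
  ext i
  fin_cases i <;> simp [helS]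

/-- The action of `M(θ)` on vectors is the helical transformation with step `0`. -/
theorem helM_mulVec (θ : ℝ) (v : Fin 3 → ℝ) : (helM θ).mulVec v = helS 0 θ v := by
  ext i
  fin_cases i <;> simp [helM, helS, Matrix.mulVec, dotProduct, Fin.sum_univ_three] <;> ring

/-- A solution of `w' = M'(0) w` is the rotation of its initial value. -/
theorem eq_helS_of_hasDerivAt {w : ℝ → Fin 3 → ℝ}
    (hw : ∀ t, HasDerivAt w ![w t 1, -(w t 0), 0] t) (θ : ℝ) :
    w θ = helS 0 θ (w 0) := by
  have h0 (t : ℝ) : HasDerivAt (fun s => w s 0) (w t 1) t := hasDerivAt_pi.1 (hw t) 0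
  have h1 (t : ℝ) : HasDerivAt (fun s => w s 1) (-(w t 0)) t := hasDerivAt_pi.1 (hw t) 1
  have h2 (t : ℝ) : HasDerivAt (fun s => w s 2) 0 t := hasDerivAt_pi.1 (hw t) 2
  have const_of {f : ℝ → ℝ} (hf : ∀ t, HasDerivAt f 0 t) : f θ = f 0 :=
    is_const_of_deriv_eq_zero (fun t => (hf t).differentiableAt) (fun t => (hf t).deriv) θ 0
  have e0 := const_of (f := fun t => w t 0 * Real.cos t - w t 1 * Real.sin t) fun t =>
    (((h0 t).mul (Real.hasDerivAt_cos t)).sub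
      ((h1 t).mul (Real.hasDerivAt_sin t))).congr_deriv (by ring)
  have e1 := const_of (f := fun t => w t 0 * Real.sin t + w t 1 * Real.cos t) fun t =>
    (((h0 t).mul (Real.hasDerivAt_sin t)).add
      ((h1 t).mul (Real.hasDerivAt_cos t))).congr_deriv (by ring)
  have e2 := const_of h2
  simp only [Real.cos_zero, Real.sin_zero, mul_one, mul_zero, sub_zero, zero_add] at e0 e1
  have hcs := Real.sin_sq_add_cos_sq θ
  ext i
  fin_cases i
  · simp only [helS, Fin.zero_eta, Matrix.cons_val_zero]
    linear_combination Real.cos θ * e0 + Real.sin θ * e1 - w θ 0 * hcs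
  · simp only [helS, Fin.mk_one, Matrix.cons_val_one, Matrix.cons_val_zero]
    linear_combination -Real.sin θ * e0 + Real.cos θ * e1 - w θ 1 * hcs
  · simpa [helS] using e2

/-- infinitesimal characterization of helical covariance: a differentiable
vector field `u` is helical covariant iff `Du(x)(x₂, −x₁, σ/(2π)) = (u₂(x), −u₁(x), 0)`
for every `x`. -/
theorem helical_covariant_iff_infinitesimal (σ : ℝ) (hσ : 0 < σ)
    (u : (Fin 3 → ℝ) → Fin 3 → ℝ) (hu : ∀ x : Fin 3 → ℝ, DifferentiableAt ℝ u x) :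
    (∀ (θ : ℝ) (x : Fin 3 → ℝ), (helM θ).mulVec (u x) = u (helS σ θ x)) ↔
    (∀ x : Fin 3 → ℝ,
      fderiv ℝ u x ![x 1, -(x 0), σ / (2 * Real.pi)] = ![u x 1, -(u x 0), 0]) := by
  have hderiv (θ : ℝ) (x : Fin 3 → ℝ) := (hu (helS σ θ x)).hasFDerivAt.comp_hasDerivAt θ
    (hasDerivAt_helS σ θ x)
  simp only [helM_mulVec]
  constructor
  · intro h x
    have hx := hderiv 0 x
    have hM := hasDerivAt_helS 0 0 (u x)
    simp only [helS_zero, zero_div] at hx hM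
    refine hx.unique (hM.congr_of_eventuallyEq (.of_forall fun t => (h t x).symm))
  · intro h θ x
    have key := eq_helS_of_hasDerivAt (w := fun t => u (helS σ t x))
      (fun t => (hderiv t x).congr_deriv (h _)) θ
    simpa only [helS_zero] using key.symm
end

section
/- L^q norm identity for helical invariant functions: let σ > 0, 1 ≤ q < ∞, let D ⊆ ℝ² be Lebesgue measurable, let D̃ ⊆ ℝ³ be its helical evolution, and let f: ℝ³ → ℝ be Lebesgue measurable and helical invariant with step σ. Then ∫_{D̃ ∩ (ℝ² × [0,σ))} |f(x)|^q dx = σ ∫_D |f(y₁, y₂, 0)|^q d(y₁,y₂), where both integrals are with respect to Lebesgue measure (in ℝ³ and ℝ² respectively). -/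
/-- The plane rotation occurring in `helS` preserves Lebesgue measure. -/
theorem measurePreserving_planeRotation (θ : ℝ) :
    MeasureTheory.MeasurePreserving (fun y : ℝ × ℝ =>
      (y.1 * Real.cos θ + y.2 * Real.sin θ, -y.1 * Real.sin θ + y.2 * Real.cos θ)) := by
  have h := (Complex.volume_preserving_equiv_real_prod.comp
    (rotation (Circle.exp (-θ))).measurePreserving).comp
    (Complex.volume_preserving_equiv_real_prod.symm Complex.measurableEquivRealProd)
  convert h using 1
  ext y
  · simp [-Circle.exp_neg, rotation_apply, Complex.exp_re, Complex.exp_im]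
    ring
  · simp [-Circle.exp_neg, rotation_apply, Complex.exp_re, Complex.exp_im]
    ring

/-- Assembling a point of `ℝ³` from its height and its horizontal part preserves Lebesgue
measure. -/
theorem measurePreserving_heightHorizontal :
    MeasureTheory.MeasurePreserving (fun p : ℝ × (ℝ × ℝ) => ![p.2.1, p.2.2, p.1]) := by
  have h := ((MeasureTheory.volume_preserving_piFinSuccAbove (fun _ : Fin 3 => ℝ) 2).symm _).comp
    ((MeasureTheory.MeasurePreserving.id (MeasureTheory.volume : MeasureTheory.Measure ℝ)).prod
      ((MeasureTheory.volume_preserving_finTwoArrow ℝ).symm _))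
  rw [← MeasureTheory.Measure.volume_eq_prod] at h
  convert h using 1
  ext p i
  fin_cases i <;> rfl

/-- The helix parametrization `(z, y) ↦ S_{2πz/σ,σ}(y, 0)`, in which `z` is the height. -/
noncomputable def helParam (σ : ℝ) (p : ℝ × (ℝ × ℝ)) : Fin 3 → ℝ :=
  ![p.2.1 * Real.cos (2 * Real.pi * p.1 / σ) + p.2.2 * Real.sin (2 * Real.pi * p.1 / σ),
    -p.2.1 * Real.sin (2 * Real.pi * p.1 / σ) + p.2.2 * Real.cos (2 * Real.pi * p.1 / σ),
    p.1]

theorem helParam_eq_helS {σ : ℝ} (hσ : σ ≠ 0) (z : ℝ) (y : ℝ × ℝ) :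
    helParam σ (z, y) = helS σ (2 * Real.pi * z / σ) ![y.1, y.2, 0] := by
  ext i
  fin_cases i
  · simp [helParam, helS]
  · simp [helParam, helS]
  · simp [helParam, helS]
    field_simp

theorem helS_eq_helParam {σ : ℝ} (hσ : σ ≠ 0) (θ : ℝ) (y : ℝ × ℝ) :
    helS σ θ ![y.1, y.2, 0] = helParam σ (σ * θ / (2 * Real.pi), y) := by
  rw [helParam_eq_helS hσ]
  congr 1
  field_simp

theorem helParam_injective (σ : ℝ) : Function.Injective (helParam σ) := by
  rintro ⟨z, a, b⟩ ⟨w, c, d⟩ h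
  have h0 := congrFun h 0
  have h1 := congrFun h 1
  obtain rfl : z = w := congrFun h 2
  simp only [helParam, Matrix.cons_val_zero, Matrix.cons_val_one] at h0 h1
  have hsc := Real.sin_sq_add_cos_sq (2 * Real.pi * z / σ)
  generalize Real.sin (2 * Real.pi * z / σ) = s at *
  generalize Real.cos (2 * Real.pi * z / σ) = t at *
  have hac : a = c := by linear_combination t * h0 - s * h1 - (a - c) * hsc
  have hbd : b = d := by linear_combination s * h0 + t * h1 - (b - d) * hsc
  rw [hac, hbd]

theorem measurableEmbedding_helParam (σ : ℝ) : MeasurableEmbedding (helParam σ) := by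
  refine Continuous.measurableEmbedding ?_ (helParam_injective σ)
  refine continuous_pi fun i => ?_
  fin_cases i <;> simp [helParam] <;> fun_prop

theorem measurePreserving_helParam (σ : ℝ) :
    MeasureTheory.MeasurePreserving (helParam σ) := by
  have hskew := (MeasureTheory.MeasurePreserving.id
      (MeasureTheory.volume : MeasureTheory.Measure ℝ)).skew_product
    (μc := (MeasureTheory.volume : MeasureTheory.Measure (ℝ × ℝ)))
    (μd := (MeasureTheory.volume : MeasureTheory.Measure (ℝ × ℝ)))
    (g := fun (z : ℝ) (y : ℝ × ℝ) =>
      (y.1 * Real.cos (2 * Real.pi * z / σ) + y.2 * Real.sin (2 * Real.pi * z / σ),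
      -y.1 * Real.sin (2 * Real.pi * z / σ) + y.2 * Real.cos (2 * Real.pi * z / σ)))
    (by fun_prop)
    (Filter.Eventually.of_forall fun z => (measurePreserving_planeRotation _).map_eq)
  exact measurePreserving_heightHorizontal.comp hskew

/-- `L^q` norm identity for helical invariant functions: the integral of
`|f|^q` over one period of the helical evolution of `D` equals `σ` times the integral of
`|f(·,·,0)|^q` over `D`. -/
theorem helical_invariant_Lq_identity (σ : ℝ) (hσ : 0 < σ) (q : ℝ) (hq : 1 ≤ q)
    (D : Set (ℝ × ℝ)) (hD : MeasurableSet D)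
    (f : (Fin 3 → ℝ) → ℝ) (hf : Measurable f)
    (hinv : ∀ (θ : ℝ) (x : Fin 3 → ℝ), f (helS σ θ x) = f x)
    (T : Set (Fin 3 → ℝ))
    (hT : T = {x : Fin 3 → ℝ | ∃ y ∈ D, ∃ θ : ℝ, x = helS σ θ ![y.1, y.2, 0]}) :
    (∫ x in T ∩ {x : Fin 3 → ℝ | x 2 ∈ Set.Ico 0 σ}, |f x| ^ q) =
      σ * ∫ y in D, |f ![y.1, y.2, 0]| ^ q := by
  have hpre : helParam σ ⁻¹' (T ∩ {x : Fin 3 → ℝ | x 2 ∈ Set.Ico 0 σ}) = Set.Ico 0 σ ×ˢ D := by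
    ext ⟨z, y⟩
    have hz : helParam σ (z, y) 2 = z := rfl
    simp only [hT, Set.mem_preimage, Set.mem_inter_iff, Set.mem_ofPred_eq, hz, Set.mem_prod]
    refine ⟨?_, fun h => ⟨⟨y, h.2, _, helParam_eq_helS hσ.ne' z y⟩, h.1⟩⟩
    rintro ⟨⟨y', hy', θ, h⟩, hmem⟩
    rw [helS_eq_helParam hσ.ne'] at h
    obtain rfl : y = y' := congrArg Prod.snd (helParam_injective σ h)
    exact ⟨hmem, hy'⟩
  have hval (p : ℝ × (ℝ × ℝ)) :
      |f (helParam σ p)| ^ q = 1 * |f ![p.2.1, p.2.2, 0]| ^ q := by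
    rw [← Prod.mk.eta (p := p), helParam_eq_helS hσ.ne', hinv, one_mul]
  rw [← (measurePreserving_helParam σ).setIntegral_preimage_emb (measurableEmbedding_helParam σ),
    hpre]
  simp_rw [hval]
  rw [MeasureTheory.Measure.volume_eq_prod,
    MeasureTheory.setIntegral_prod_mul (fun _ : ℝ => (1 : ℝ))
      (fun y : ℝ × ℝ => |f ![y.1, y.2, 0]| ^ q)]
  simp [hσ.le]
end
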